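/- arXiv:1307.4056 — 2 statements merged into one kernel-verified Lean document; each statement's English description precedes it below -/
import Mathlib

section
/- Let T_n(t) = 2^{1-n} |sin(nt/2)|. For every even positive integer m, -(log|T_n|)^{(m)}(π/n) = (2/(2π)^m) ζ(m) (m-1)! (2^m - 1). In particular, -(log|T_n|)^{(2)}(π/n) = n²/4, -(log|T_n|)^{(4)}(π/n) = n⁴/8, and -(log|T_n|)^{(6)}(π/n) = n⁶/4. -/
open Real Complex

/-- The formal Taylor series at `x` of a function of a real variable. -/
noncomputable def formalTaylor (f : ℝ → ℂ) (x : ℝ) : PowerSeries ℂ :=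
  PowerSeries.mk fun k => iteratedDeriv k f x / (k.factorial : ℂ)

theorem formalTaylor_mul {f g : ℝ → ℂ} {x : ℝ} (hf : ∀ k : ℕ, ContDiffAt ℝ k f x)
    (hg : ∀ k : ℕ, ContDiffAt ℝ k g x) :
    formalTaylor (f * g) x = formalTaylor f x * formalTaylor g x := by
  ext k
  simp only [formalTaylor, PowerSeries.coeff_mk, PowerSeries.coeff_mul]
  rw [iteratedDeriv_mul (hf k) (hg k), Finset.sum_div,
    Finset.Nat.sum_antidiagonal_eq_sum_range_succ
      (fun i j => iteratedDeriv i f x / (i.factorial : ℂ) * (iteratedDeriv j g x / (j.factorial : ℂ)))]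
  refine Finset.sum_congr rfl fun i hi => ?_
  have hik : i ≤ k := Nat.lt_succ_iff.mp (Finset.mem_range.mp hi)
  have h1 : (k.factorial : ℂ) ≠ 0 := mod_cast k.factorial_ne_zero
  have h2 : (i.factorial : ℂ) ≠ 0 := mod_cast i.factorial_ne_zero
  have h3 : ((k - i).factorial : ℂ) ≠ 0 := mod_cast (k - i).factorial_ne_zero
  rw [Nat.cast_choose ℂ hik]
  field_simp

theorem formalTaylor_congr {f g : ℝ → ℂ} {x : ℝ} (h : f =ᶠ[nhds x] g) :
    formalTaylor f x = formalTaylor g x := by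
  ext k
  simp [formalTaylor, h.iteratedDeriv_eq k]

theorem iteratedDeriv_cexp_const_mul_ofReal (c : ℂ) (k : ℕ) :
    iteratedDeriv k (fun u : ℝ => Complex.exp (c * u)) =
      fun u : ℝ => c ^ k * Complex.exp (c * u) := by
  induction k with
  | zero => simp
  | succ k ih =>
    rw [iteratedDeriv_succ, ih]
    funext u
    have h : HasDerivAt (fun u : ℝ => c * (u : ℂ)) (c * 1) u :=
      (Complex.ofRealCLM.hasDerivAt (x := u)).const_mul c
    rw [(h.cexp.const_mul (c ^ k)).deriv]
    ring

theorem contDiff_cexp_const_mul_ofReal (c : ℂ) (k : ℕ) :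
    ContDiff ℝ k (fun u : ℝ => Complex.exp (c * u)) :=
  (contDiff_const.mul Complex.ofRealCLM.contDiff).cexp

theorem formalTaylor_cexp_add_const (c d : ℂ) :
    formalTaylor (fun u : ℝ => Complex.exp (c * u) + d) 0 =
      PowerSeries.rescale c (PowerSeries.exp ℂ) + PowerSeries.C d := by
  ext k
  have h : iteratedDeriv k (fun u : ℝ => Complex.exp (c * u) + d) 0 =
      c ^ k + if k = 0 then d else 0 := by
    have : iteratedDeriv k (fun u : ℝ => Complex.exp (c * u) + d) 0 = _ :=
      iteratedDeriv_add (contDiff_cexp_const_mul_ofReal c k).contDiffAt (contDiffAt_const (c := d))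
    rw [iteratedDeriv_cexp_const_mul_ofReal, iteratedDeriv_const] at this
    simpa using this
  simp only [formalTaylor, PowerSeries.coeff_mk, h, map_add, PowerSeries.coeff_rescale,
    PowerSeries.coeff_exp, PowerSeries.coeff_C]
  rcases eq_or_ne k 0 with rfl | hk
  · simp
  · simp [hk, div_eq_mul_inv]

/-- `(eˣ - 1) / (eˣ + 1)` in terms of the Bernoulli generating function, after the
substitution `x ↦ c x`. -/
theorem X_mul_eq_of_mul_exp_add_one {c : ℂ} (hc : c ≠ 0) {S : PowerSeries ℂ}
    (hS : S * (PowerSeries.rescale c (PowerSeries.exp ℂ) + 1) =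
      PowerSeries.rescale c (PowerSeries.exp ℂ) - 1) :
    PowerSeries.C c * PowerSeries.X * S = PowerSeries.C c * PowerSeries.X -
      2 * (PowerSeries.rescale c (bernoulliPowerSeries ℂ) -
        PowerSeries.rescale (2 * c) (bernoulliPowerSeries ℂ)) := by
  have hE : PowerSeries.rescale (2 * c) (PowerSeries.exp ℂ) =
      PowerSeries.rescale c (PowerSeries.exp ℂ) ^ 2 := by
    rw [← map_pow, PowerSeries.exp_pow_eq_rescale_exp, PowerSeries.rescale_rescale]
    simp [mul_comm]
  have hB := congr_arg (PowerSeries.rescale c) (bernoulliPowerSeries_mul_exp_sub_one ℂ)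
  have hD := congr_arg (PowerSeries.rescale (2 * c)) (bernoulliPowerSeries_mul_exp_sub_one ℂ)
  simp only [map_mul, map_sub, map_one, PowerSeries.rescale_X, hE] at hB hD
  have h2 : PowerSeries.C (2 : ℂ) = 2 := map_ofNat _ 2
  rw [h2] at hD
  have hne1 : PowerSeries.rescale c (PowerSeries.exp ℂ) - 1 ≠ 0 := by
    intro h
    have := congr_arg (PowerSeries.coeff 1) h
    simp [PowerSeries.coeff_rescale, PowerSeries.coeff_exp, PowerSeries.coeff_one, hc] at this
  have hne2 : PowerSeries.rescale c (PowerSeries.exp ℂ) + 1 ≠ 0 := by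
    intro h
    have := congr_arg (PowerSeries.coeff 0) h
    simp only [map_add, PowerSeries.coeff_rescale, PowerSeries.coeff_exp,
      PowerSeries.coeff_one] at this
    norm_num at this
  set E := PowerSeries.rescale c (PowerSeries.exp ℂ)
  apply mul_right_cancel₀ (mul_ne_zero hne1 hne2)
  linear_combination (PowerSeries.C c * PowerSeries.X * (E - 1)) * hS + 2 * (E + 1) * hB - 2 * hD

theorem contDiffAt_tan_const_mul_zero (a : ℝ) (k : ℕ) :
    ContDiffAt ℝ k (fun u : ℝ => Real.tan (a * u)) 0 := by
  have h : ContDiffAt ℝ k Real.tan (a * 0) := Real.contDiffAt_tan.mpr (by simp)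
  exact h.comp (0 : ℝ) (contDiffAt_const.mul contDiffAt_id)

theorem ofReal_iteratedDeriv {f : ℝ → ℝ} {x : ℝ} {k : ℕ} (hf : ContDiffAt ℝ k f x) :
    ((iteratedDeriv k f x : ℝ) : ℂ) = iteratedDeriv k (fun u => (f u : ℂ)) x := by
  have := Complex.ofRealCLM.iteratedFDeriv_comp_left hf (i := k) le_rfl
  have := congr($this fun _ => 1)
  simpa [iteratedDeriv, Function.comp_def] using this.symm

theorem I_mul_tan_mul_exp_add_one {x : ℝ} (hx : Real.cos x ≠ 0) :
    Complex.I * (Real.tan x : ℂ) * (Complex.exp (2 * Complex.I * x) + 1) =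
      Complex.exp (2 * Complex.I * x) - 1 := by
  have hx' : Complex.cos x ≠ 0 := by rw [← Complex.ofReal_cos]; exact_mod_cast hx
  have hE : Complex.exp (2 * Complex.I * x) = (Complex.cos x + Complex.sin x * Complex.I) ^ 2 := by
    rw [← Complex.exp_mul_I, ← Complex.exp_nat_mul]
    congr 1
    push_cast
    ring
  rw [hE, Complex.ofReal_tan, Complex.tan_eq_sin_div_cos]
  field_simp
  linear_combination (Complex.cos x + Complex.I * Complex.sin x) *
    (Complex.sin x ^ 2 * Complex.I_sq - Complex.sin_sq_add_cos_sq x)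

theorem iteratedDeriv_tan_const_mul {a : ℝ} (ha : a ≠ 0) {m : ℕ} (hm : 2 ≤ m) :
    ((a * iteratedDeriv (m - 1) (fun u : ℝ => Real.tan (a * u)) 0 : ℝ) : ℂ) =
      -((m - 1).factorial * (2 * Complex.I * a) ^ m * (2 ^ m - 1) * bernoulli m
        / m.factorial) := by
  set c : ℂ := 2 * Complex.I * a with hc
  have hc0 : c ≠ 0 := by simp [hc, ha]
  let f : ℝ → ℂ := fun u => (Real.tan (a * u) : ℂ)
  have hf : ∀ k : ℕ, ContDiffAt ℝ k (fun u => Complex.I * f u) 0 := fun k =>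
    contDiffAt_const.mul
      (Complex.ofRealCLM.contDiff.contDiffAt.comp (0 : ℝ) (contDiffAt_tan_const_mul_zero a k))
  have hev : (fun u => Complex.I * f u) * (fun u : ℝ => Complex.exp (c * u) + 1) =ᶠ[nhds 0]
      fun u : ℝ => Complex.exp (c * u) + (-1) := by
    have hcont : ContinuousAt (fun u : ℝ => Real.cos (a * u)) 0 := by fun_prop
    filter_upwards [hcont.eventually_ne (by simp : Real.cos (a * 0) ≠ 0)] with u hu
    have := I_mul_tan_mul_exp_add_one hu
    simp only [Pi.mul_apply, f, hc]
    push_cast at this ⊢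
    rw [← mul_assoc] at this
    linear_combination this
  have hS := formalTaylor_congr hev
  rw [formalTaylor_mul hf (fun k =>
    ((contDiff_cexp_const_mul_ofReal c k).add contDiff_const).contDiffAt),
    formalTaylor_cexp_add_const, formalTaylor_cexp_add_const, map_one, map_neg, map_one,
    ← sub_eq_add_neg] at hS
  have key := congr_arg (PowerSeries.coeff m) (X_mul_eq_of_mul_exp_add_one hc0 hS)
  obtain ⟨k, rfl⟩ : ∃ k, m = k + 1 := ⟨m - 1, by omega⟩
  have hk : k ≠ 0 := by omega
  have h2 : (2 : PowerSeries ℂ) = PowerSeries.C (2 : ℂ) := (map_ofNat _ 2).symm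
  rw [h2] at key
  simp only [mul_assoc, map_sub, PowerSeries.coeff_C_mul, PowerSeries.coeff_succ_X_mul,
    PowerSeries.coeff_rescale, PowerSeries.coeff_X, bernoulliPowerSeries, PowerSeries.coeff_mk,
    formalTaylor, iteratedDeriv_const_mul_field] at key
  have hfac : (k.factorial : ℂ) ≠ 0 := mod_cast k.factorial_ne_zero
  have hreal : ((iteratedDeriv k (fun u : ℝ => Real.tan (a * u)) 0 : ℝ) : ℂ) =
      iteratedDeriv k f 0 := ofReal_iteratedDeriv (contDiffAt_tan_const_mul_zero a k)
  simp only [Nat.add_sub_cancel, Complex.ofReal_mul, hreal]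
  have ha' : (a : ℂ) = -(c * Complex.I) / 2 := by
    rw [hc]
    linear_combination (a : ℂ) * Complex.I_sq
  rw [ha']
  simp only [hk, Nat.add_eq_right, if_false, mul_zero, mul_pow, map_div₀, eq_ratCast,
    Rat.cast_natCast] at key
  field_simp at key ⊢
  linear_combination (-1 : ℂ) * key

theorem deriv_neg_log_mul_abs_sin {b : ℝ} (hb : b ≠ 0) (a t : ℝ) (h : Real.sin (a * t) ≠ 0) :
    deriv (fun t => -Real.log (b * |Real.sin (a * t)|)) t =
      -(a * (Real.cos (a * t) / Real.sin (a * t))) := by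
  have hs : HasDerivAt (fun t => Real.sin (a * t)) (Real.cos (a * t) * (a * 1)) t :=
    ((hasDerivAt_id t).const_mul a).sin
  have hev : (fun t => -Real.log (b * |Real.sin (a * t)|)) =ᶠ[nhds t]
      fun t => -(Real.log b + Real.log (Real.sin (a * t))) := by
    filter_upwards [hs.continuousAt.eventually_ne h] with s hs
    rw [Real.log_mul hb (abs_ne_zero.mpr hs), Real.log_abs]
  have hd : HasDerivAt (fun t => -(Real.log b + Real.log (Real.sin (a * t)))) _ t :=
    ((hs.log h).const_add _).neg
  rw [hev.deriv_eq, hd.deriv]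
  ring

theorem iteratedDeriv_neg_log_mul_abs_sin {b a : ℝ} (hb : b ≠ 0) (ha : a ≠ 0) {m : ℕ}
    (hm : 1 ≤ m) :
    iteratedDeriv m (fun t => -Real.log (b * |Real.sin (a * t)|)) (Real.pi / 2 / a) =
      a * iteratedDeriv (m - 1) (fun u => Real.tan (a * u)) 0 := by
  obtain ⟨k, rfl⟩ : ∃ k, m = k + 1 := ⟨m - 1, by omega⟩
  have hcont : ContinuousAt (fun t => Real.sin (a * t)) (Real.pi / 2 / a) := by fun_prop
  have hne : Real.sin (a * (Real.pi / 2 / a)) ≠ 0 := by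
    rw [mul_div_cancel₀ _ ha]
    simp
  have hev : deriv (fun t => -Real.log (b * |Real.sin (a * t)|)) =ᶠ[nhds (Real.pi / 2 / a)]
      fun t => a * (fun u => Real.tan (a * u)) (t - Real.pi / 2 / a) := by
    filter_upwards [hcont.eventually_ne hne] with t ht
    rw [deriv_neg_log_mul_abs_sin hb a t ht]
    have : a * (t - Real.pi / 2 / a) = a * t - Real.pi / 2 := by field_simp
    simp only [this, Real.tan_eq_sin_div_cos, Real.sin_sub_pi_div_two, Real.cos_sub_pi_div_two]
    ring
  rw [iteratedDeriv_succ', hev.iteratedDeriv_eq, iteratedDeriv_const_mul_field,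
    iteratedDeriv_comp_sub_const (f := fun u => Real.tan (a * u))]
  simp

theorem log_T_derivs (n : ℕ) (hn : 1 ≤ n) (F : ℝ → ℝ)
    (hF : F = fun t => -Real.log ((2 : ℝ) ^ ((1 : ℤ) - n) * |Real.sin (n * t / 2)|)) :
    (∀ m : ℕ, Even m → 2 ≤ m →
      (Complex.ofReal (iteratedDeriv m F (Real.pi / n)))
        = 2 / (2 * Real.pi) ^ m * riemannZeta m * (Nat.factorial (m - 1))
            * (2 ^ m - 1) * (n : ℂ) ^ m) ∧
    iteratedDeriv 2 F (Real.pi / n) = (n : ℝ) ^ 2 / 4 ∧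
    iteratedDeriv 4 F (Real.pi / n) = (n : ℝ) ^ 4 / 8 ∧
    iteratedDeriv 6 F (Real.pi / n) = (n : ℝ) ^ 6 / 4 := by
  have hn0 : (n : ℝ) / 2 ≠ 0 := by positivity
  have bernoulli_form : ∀ m : ℕ, 2 ≤ m → ((iteratedDeriv m F (Real.pi / n) : ℝ) : ℂ) =
      -((m - 1).factorial * (Complex.I * n) ^ m * (2 ^ m - 1) * bernoulli m
        / m.factorial) := by
    intro m hm
    have hF' : F = fun t => -Real.log ((2 : ℝ) ^ ((1 : ℤ) - n) * |Real.sin (n / 2 * t)|) := by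
      rw [hF]
      funext t
      rw [div_mul_eq_mul_div]
    have hpt : Real.pi / n = Real.pi / 2 / ((n : ℝ) / 2) := by field_simp
    rw [hF', hpt, iteratedDeriv_neg_log_mul_abs_sin (by positivity) hn0 (by omega),
      iteratedDeriv_tan_const_mul hn0 hm]
    have : 2 * Complex.I * ((n / 2 : ℝ) : ℂ) = Complex.I * n := by
      push_cast
      ring
    rw [this]
  refine ⟨fun m hm h2 => ?_, ?_, ?_, ?_⟩
  · rw [bernoulli_form m h2]
    obtain ⟨k, rfl⟩ := even_iff_exists_two_mul.mp hm
    have hpi : (Real.pi : ℂ) ≠ 0 := mod_cast Real.pi_ne_zero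
    have hk : k ≠ 0 := by omega
    have h2k : (2 : ℂ) ^ (2 * k) = 2 * 2 ^ (2 * k - 1) := by
      rw [← pow_succ']
      congr 1
      omega
    rw [Nat.cast_mul, Nat.cast_ofNat, riemannZeta_two_mul_nat hk, mul_pow, mul_pow,
      pow_mul Complex.I, Complex.I_sq, pow_succ, h2k]
    field_simp
  all_goals
    apply Complex.ofReal_injective
    rw [bernoulli_form _ (by norm_num)]
  · norm_num [mul_pow, bernoulli_two, Nat.factorial]
    ring
  · have : bernoulli 4 = -1 / 30 := by
      rw [bernoulli_eq_bernoulli'_of_ne_one (by norm_num), bernoulli'_four]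
    norm_num [mul_pow, this, Nat.factorial]
    ring
  · have hI : Complex.I ^ 6 = -1 := by
      rw [show 6 = 2 * 3 by rfl, pow_mul, Complex.I_sq]
      norm_num
    have : bernoulli 6 = 1 / 42 := by
      rw [bernoulli_eq_bernoulli'_of_ne_one (by norm_num), bernoulli'_def]
      norm_num [Finset.sum_range_succ, Nat.choose,
        bernoulli'_eq_zero_of_odd (n := 5) (by decide) (by norm_num)]
    norm_num [mul_pow, this, hI, Nat.factorial]
    ring
end

section
/- For every even positive integer m and every configuration of n angles ω_n = (t_1, ..., t_n), max over ω_n of min_{t ∈ [0,2π)} of -(log|Q_{ω_n}|)^{(m)}(t) equals -(log|T_n|)^{(m)}(π/n), where Q_{ω_n}(t) = ∏_{j=1}^n sin|(t - t_j)/2| and T_n(t) = 2^{1-n}|sin(nt/2)|. -/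
open Real Set

section Kernel

open Polynomial

/-- The function `-cot (x / 2) / 2`, a solution of `w' = 1 / 4 + w ^ 2`. -/
noncomputable def negHalfCot (x : ℝ) : ℝ := -(cos (x / 2) / (2 * sin (x / 2)))

/-- The polynomial `P` for which the `(k + 1)`-st derivative of `-log |sin (x / 2)|` is
`P (-cot (x / 2) / 2)`. -/
noncomputable def logSinPoly : ℕ → ℝ[X]
  | 0 => X
  | k + 1 => (C (1 / 4) + X ^ 2) * derivative (logSinPoly k)

/-- The `(k + 1)`-st derivative of `-log |sin (x / 2)|`. -/
noncomputable def logSinKernel (k : ℕ) (x : ℝ) : ℝ := (logSinPoly k).eval (negHalfCot x)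

lemma logSinPoly_coeff_nonneg (k i : ℕ) : 0 ≤ (logSinPoly k).coeff i := by
  induction k generalizing i with
  | zero => simp only [logSinPoly, coeff_X]; split_ifs <;> norm_num
  | succ k ih =>
    rw [logSinPoly, coeff_mul]
    refine Finset.sum_nonneg fun p _ => mul_nonneg ?_ ?_
    · rw [coeff_add, coeff_C, coeff_X_pow]
      split_ifs <;> norm_num
    · rw [coeff_derivative]
      exact mul_nonneg (ih _) (by positivity)

lemma logSinPoly_comp_neg (k : ℕ) :
    (logSinPoly k).comp (-X) = (-1) ^ (k + 1) * logSinPoly k := by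
  induction k with
  | zero => simp [logSinPoly]
  | succ k ih =>
    have h := congrArg derivative ih
    have e : ((-1 : ℝ[X]) ^ (k + 1)) = C ((-1 : ℝ) ^ (k + 1)) := by simp
    rw [derivative_comp, e, derivative_C_mul, ← e] at h
    simp only [derivative_neg, derivative_X] at h
    have h' : (derivative (logSinPoly k)).comp (-X)
        = (-1) ^ (k + 2) * derivative (logSinPoly k) := by
      rw [pow_succ]; linear_combination -h
    rw [logSinPoly, mul_comp, h']
    simp only [add_comp, C_comp, pow_comp, X_comp]
    ring

lemma logSinPoly_eval_neg {k : ℕ} (hk : Odd k) (w : ℝ) :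
    (logSinPoly k).eval (-w) = (logSinPoly k).eval w := by
  have h := congrArg (eval w) (logSinPoly_comp_neg k)
  simpa [eval_comp, hk.add_one.neg_one_pow] using h

lemma logSinPoly_eval_zero_le {k : ℕ} (hk : Odd k) (w : ℝ) :
    (logSinPoly k).eval 0 ≤ (logSinPoly k).eval w := by
  have h : (logSinPoly k).eval w = (logSinPoly k).eval |w| := by
    rcases abs_choice w with h | h <;> rw [h]
    exact (logSinPoly_eval_neg hk w).symm
  rw [h, ← coeff_zero_eq_eval_zero, eval_eq_sum_range]
  refine le_trans (by simp) (Finset.single_le_sum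
    (f := fun i => (logSinPoly k).coeff i * |w| ^ i) (fun i _ => ?_)
    (Finset.mem_range.2 (Nat.succ_pos _)))
  exact mul_nonneg (logSinPoly_coeff_nonneg k i) (by positivity)

lemma logSinPoly_eval_nonneg {k : ℕ} (hk : Odd k) (w : ℝ) : 0 ≤ (logSinPoly k).eval w := by
  refine le_trans ?_ (logSinPoly_eval_zero_le hk w)
  rw [← coeff_zero_eq_eval_zero]
  exact logSinPoly_coeff_nonneg k 0

lemma hasDerivAt_negHalfCot {x : ℝ} (hx : sin (x / 2) ≠ 0) :
    HasDerivAt negHalfCot (1 / 4 + negHalfCot x ^ 2) x := by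
  have h2 : HasDerivAt (fun x : ℝ => x / 2) (1 / 2) x := (hasDerivAt_id x).div_const 2
  have h := (h2.cos.div (h2.sin.const_mul 2) (mul_ne_zero two_ne_zero hx)).neg
  refine h.congr_deriv ?_
  unfold negHalfCot
  field_simp
  ring_nf

lemma hasDerivAt_logSinKernel (k : ℕ) {x : ℝ} (hx : sin (x / 2) ≠ 0) :
    HasDerivAt (logSinKernel k) (logSinKernel (k + 1) x) x := by
  have h := ((logSinPoly k).hasDerivAt (negHalfCot x)).comp x (hasDerivAt_negHalfCot hx)
  refine h.congr_deriv ?_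
  simp only [logSinKernel, logSinPoly, eval_mul, eval_add, eval_C, eval_pow, eval_X]
  ring

lemma logSinKernel_neg {k : ℕ} (hk : Odd k) (x : ℝ) :
    logSinKernel k (-x) = logSinKernel k x := by
  have h : negHalfCot (-x) = -negHalfCot x := by
    simp only [negHalfCot, neg_div, cos_neg, sin_neg, mul_neg, div_neg]
  rw [logSinKernel, h, logSinPoly_eval_neg hk, logSinKernel]

lemma logSinKernel_periodic (k : ℕ) : Function.Periodic (logSinKernel k) (2 * π) := by
  intro x
  have h : negHalfCot (x + 2 * π) = negHalfCot x := by
    have e : (x + 2 * π) / 2 = x / 2 + π := by ring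
    simp only [negHalfCot, e, cos_add_pi, sin_add_pi, mul_neg, neg_div_neg_eq]
  rw [logSinKernel, h, logSinKernel]

lemma logSinKernel_nonneg {k : ℕ} (hk : Odd k) (x : ℝ) : 0 ≤ logSinKernel k x :=
  logSinPoly_eval_nonneg hk _

lemma logSinKernel_pi_le {k : ℕ} (hk : Odd k) (x : ℝ) : logSinKernel k π ≤ logSinKernel k x := by
  have h : negHalfCot π = 0 := by simp [negHalfCot]
  rw [logSinKernel, h]
  exact logSinPoly_eval_zero_le hk _

lemma sin_half_ne_zero {x : ℝ} (hx : x ∈ Ioo 0 (2 * π)) : sin (x / 2) ≠ 0 :=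
  (sin_pos_of_pos_of_lt_pi (by linarith [hx.1]) (by linarith [hx.2])).ne'

lemma monotoneOn_logSinKernel_succ {k : ℕ} (hk : Odd k) :
    MonotoneOn (logSinKernel (k + 1)) (Ioo 0 (2 * π)) := by
  have hd (x) (hx : x ∈ Ioo 0 (2 * π)) := hasDerivAt_logSinKernel (k + 1) (sin_half_ne_zero hx)
  refine monotoneOn_of_deriv_nonneg (convex_Ioo _ _)
    (fun x hx => (hd x hx).continuousAt.continuousWithinAt) ?_ ?_ <;> rw [interior_Ioo]
  · exact fun x hx => (hd x hx).differentiableAt.differentiableWithinAt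
  · intro x hx
    rw [(hd x hx).deriv]
    exact logSinKernel_nonneg (by simpa [Nat.odd_add] using hk) x

lemma convexOn_logSinKernel {k : ℕ} (hk : Odd k) :
    ConvexOn ℝ (Ioo 0 (2 * π)) (logSinKernel k) := by
  have hd (x) (hx : x ∈ Ioo 0 (2 * π)) := hasDerivAt_logSinKernel k (sin_half_ne_zero hx)
  refine MonotoneOn.convexOn_of_deriv (convex_Ioo _ _)
    (fun x hx => (hd x hx).continuousAt.continuousWithinAt) ?_ ?_ <;> rw [interior_Ioo]
  · exact fun x hx => (hd x hx).differentiableAt.differentiableWithinAt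
  · exact (monotoneOn_logSinKernel_succ hk).congr fun x hx => (hd x hx).deriv.symm

lemma logSinKernel_tangent_le {k : ℕ} (hk : Odd k) {x y : ℝ} (hx : x ∈ Ioo 0 (2 * π))
    (hy : y ∈ Ioo 0 (2 * π)) :
    logSinKernel k x + logSinKernel (k + 1) x * (y - x) ≤ logSinKernel k y := by
  have hd := hasDerivAt_logSinKernel k (sin_half_ne_zero hx)
  rcases lt_trichotomy x y with h | rfl | h
  · have := (convexOn_logSinKernel hk).le_slope_of_hasDerivAt hx hy h hd
    rw [slope_def_field, le_div_iff₀ (by linarith)] at this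
    linarith
  · simp
  · have := (convexOn_logSinKernel hk).slope_le_of_hasDerivAt hy hx h hd
    rw [slope_def_field, div_le_iff₀ (by linarith)] at this
    linarith

lemma iteratedDeriv_log_prod_sin {ι : Type*} [Fintype ι] {c : ℝ} (hc : c ≠ 0) (ω : ι → ℝ)
    (k : ℕ) {t : ℝ} (ht : ∏ j, sin ((t - ω j) / 2) ≠ 0) :
    iteratedDeriv (k + 1) (fun s => log |c * ∏ j, sin ((s - ω j) / 2)|) t =
      -∑ j, logSinKernel k (t - ω j) := by
  have hopen : IsOpen {t : ℝ | ∏ j, sin ((t - ω j) / 2) ≠ 0} :=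
    isOpen_ne_fun (by fun_prop) continuous_const
  induction k generalizing t with
  | zero =>
    have heq : (fun s => log |c * ∏ j, sin ((s - ω j) / 2)|) =ᶠ[nhds t]
        fun s => log c + ∑ j, log (sin ((s - ω j) / 2)) := by
      filter_upwards [hopen.mem_nhds ht] with s hs
      rw [log_abs, log_mul hc hs, log_prod fun j hj => (Finset.prod_ne_zero_iff.1 hs) j hj]
    rw [zero_add, iteratedDeriv_one, heq.deriv_eq, ← Finset.sum_neg_distrib]
    refine HasDerivAt.deriv (HasDerivAt.const_add _ (HasDerivAt.fun_sum fun j hj => ?_))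
    have h0 := (Finset.prod_ne_zero_iff.1 ht) j hj
    have h2 : HasDerivAt (fun x : ℝ => (x - ω j) / 2) (1 / 2) t :=
      ((hasDerivAt_id t).sub_const _).div_const 2
    refine (h2.sin.log h0).congr_deriv ?_
    simp only [logSinKernel, logSinPoly, eval_X, negHalfCot, neg_neg]
    field_simp
  | succ k ih =>
    have heq : iteratedDeriv (k + 1) (fun s => log |c * ∏ j, sin ((s - ω j) / 2)|) =ᶠ[nhds t]
        fun t => -∑ j, logSinKernel k (t - ω j) := by
      filter_upwards [hopen.mem_nhds ht] with s hs using ih hs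
    rw [iteratedDeriv_succ, heq.deriv_eq]
    refine HasDerivAt.deriv (HasDerivAt.fun_neg (HasDerivAt.fun_sum fun j hj => ?_))
    have h0 := (Finset.prod_ne_zero_iff.1 ht) j hj
    exact (hasDerivAt_logSinKernel k h0).comp_sub_const t (ω j)

end Kernel

section Scaling

lemma iteratedDeriv_comp_mul_left_field (m : ℕ) (f : ℝ → ℝ) (a : ℝ) :
    iteratedDeriv m (fun x => f (a * x)) = fun x => a ^ m * iteratedDeriv m f (a * x) := by
  induction m with
  | zero => simp
  | succ m ih =>
    funext x
    rw [iteratedDeriv_succ, ih, deriv_const_mul_field, iteratedDeriv_succ,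
      deriv_comp_mul_left, smul_eq_mul]
    ring

/-- The product formula for sines at equally spaced points. -/
lemma abs_prod_sin_equally_spaced {n : ℕ} (hn : 1 ≤ n) (s : ℝ) :
    |∏ j : Fin n, sin ((s - 2 * π * j / n) / 2)| =
      |(2 : ℝ) ^ ((1 : ℤ) - n) * sin (n * s / 2)| := by
  have hζ := Complex.isPrimitiveRoot_exp n (by omega)
  have key (u : ℝ) : ‖Complex.exp (Complex.I * u) - 1‖ = 2 * |sin (u / 2)| := by
    rw [Complex.norm_exp_I_mul_ofReal_sub_one]; simp
  have h := congrArg (fun p => ‖p.eval (Complex.exp (Complex.I * s))‖)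
    (X_pow_sub_C_eq_prod hζ hn (one_pow n))
  simp only [Polynomial.eval_sub, Polynomial.eval_pow, Polynomial.eval_X, Polynomial.eval_C,
    Polynomial.eval_prod, norm_prod, mul_one] at h
  have hl : Complex.exp (Complex.I * s) ^ n = Complex.exp (Complex.I * ((n * s : ℝ) : ℂ)) := by
    rw [← Complex.exp_nat_mul]; congr 1; push_cast; ring
  have hr (j : ℕ) : ‖Complex.exp (Complex.I * s) -
      Complex.exp (2 * π * Complex.I / n) ^ j‖ = 2 * |sin ((s - 2 * π * j / n) / 2)| := by
    rw [← key, ← Complex.exp_nat_mul]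
    have e : Complex.exp (Complex.I * s) =
        Complex.exp (Complex.I * ((2 * π * j / n : ℝ) : ℂ)) *
          Complex.exp (Complex.I * ((s - 2 * π * j / n : ℝ) : ℂ)) := by
      rw [← Complex.exp_add]; congr 1; push_cast; ring
    have e2 : (j : ℂ) * (2 * π * Complex.I / n) = Complex.I * ((2 * π * j / n : ℝ) : ℂ) := by
      push_cast; ring
    rw [e, e2, ← mul_sub_one, norm_mul, mul_comm Complex.I, Complex.norm_exp_ofReal_mul_I,
      one_mul]
  rw [hl, key] at h
  simp only [hr] at h
  rw [Finset.prod_mul_distrib, Finset.prod_const, Finset.card_range] at h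
  rw [Finset.abs_prod, abs_mul, Fin.prod_univ_eq_prod_range
    (fun j : ℕ => |sin ((s - 2 * π * j / n) / 2)|) n, zpow_sub₀ two_ne_zero, zpow_one,
    zpow_natCast, abs_of_pos (by positivity : (0 : ℝ) < 2 / 2 ^ n),
    div_mul_eq_mul_div, h, mul_div_cancel_left₀ _ (by positivity)]

end Scaling

section Majorization

lemma sum_mul_le_of_monotone_of_partial_sums_nonneg (c b : ℕ → ℝ) (n : ℕ)
    (hc : ∀ i j, i ≤ j → j ≤ n → c i ≤ c j)
    (hb : ∀ k ≤ n, 0 ≤ ∑ j ∈ Finset.range k, b j) :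
    ∑ j ∈ Finset.range (n + 1), c j * b j ≤ c n * ∑ j ∈ Finset.range (n + 1), b j := by
  induction n with
  | zero => simp
  | succ n ih =>
    have h := ih (fun i j hij hj => hc i j hij (by omega)) fun k hk => hb k (by omega)
    rw [Finset.sum_range_succ, Finset.sum_range_succ b (n + 1), mul_add]
    have := mul_le_mul_of_nonneg_right (hc n (n + 1) (by omega) le_rfl) (hb (n + 1) le_rfl)
    linarith

/-- Karamata's inequality for the kernel: `y` majorizes `x`. -/
lemma sum_logSinKernel_le_of_partial_sums {k : ℕ} (hk : Odd k) (x y : ℕ → ℝ) (n : ℕ)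
    (hx : ∀ j < n, x j ∈ Ioo 0 (2 * π)) (hy : ∀ j < n, y j ∈ Ioo 0 (2 * π))
    (hmono : Monotone x)
    (hb : ∀ l, 0 ≤ ∑ j ∈ Finset.range l, (x j - y j))
    (h0 : ∑ j ∈ Finset.range n, (x j - y j) = 0) :
    ∑ j ∈ Finset.range n, logSinKernel k (x j) ≤ ∑ j ∈ Finset.range n, logSinKernel k (y j) := by
  rcases n with _ | n
  · simp
  have h := sum_mul_le_of_monotone_of_partial_sums_nonneg
    (fun j => logSinKernel (k + 1) (x j)) (fun j => x j - y j) n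
    (fun i j hij hj => monotoneOn_logSinKernel_succ hk (hx i (by omega)) (hx j (by omega))
      (hmono hij)) (fun l _ => hb l)
  rw [h0, mul_zero] at h
  have h2 : ∑ j ∈ Finset.range (n + 1), logSinKernel k (x j) ≤
      ∑ j ∈ Finset.range (n + 1),
        (logSinKernel k (y j) + logSinKernel (k + 1) (x j) * (x j - y j)) := by
    refine Finset.sum_le_sum fun j hj => ?_
    have hj := Finset.mem_range.1 hj
    linarith [logSinKernel_tangent_le hk (hx j hj) (hy j hj)]
  rw [Finset.sum_add_distrib] at h2
  linarith

lemma sum_range_shift_of_periodic (F : ℕ → ℝ) (n p : ℕ) (hF : ∀ i, F (i + n) = F i) :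
    ∑ j ∈ Finset.range n, F (p + j) = ∑ j ∈ Finset.range n, F j := by
  induction p with
  | zero => simp
  | succ p ih =>
    rw [← ih]
    have h1 := Finset.sum_range_succ (fun j => F (p + j)) n
    have h2 := Finset.sum_range_succ' (fun j => F (p + j)) n
    simp only [hF, add_zero] at h1 h2
    have h3 : ∑ j ∈ Finset.range n, F (p + 1 + j) = ∑ j ∈ Finset.range n, F (p + (j + 1)) :=
      Finset.sum_congr rfl fun j _ => by congr 1; ring
    linarith

/-- Every periodic sequence of mean zero has a cyclic shift with nonnegative partial sums. -/
lemma exists_shift_partial_sums_nonneg (b : ℕ → ℝ) {n : ℕ} (hn : 1 ≤ n)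
    (hb : ∀ i, b (i + n) = b i) (h0 : ∑ j ∈ Finset.range n, b j = 0) :
    ∃ p < n, ∀ l, 0 ≤ ∑ j ∈ Finset.range l, b (p + j) := by
  set B : ℕ → ℝ := fun l => ∑ j ∈ Finset.range l, b j with hB
  have hper (l) : B (l + n) = B l := by
    simp only [hB]
    rw [add_comm l n, Finset.sum_range_add, h0, zero_add]
    exact Finset.sum_congr rfl fun j _ => by rw [add_comm, hb]
  obtain ⟨p, hp, hmin⟩ := Finset.exists_min_image (Finset.range n) B
    (Finset.nonempty_range_iff.2 (by omega))
  refine ⟨p, Finset.mem_range.1 hp, fun l => ?_⟩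
  have h1 : B (p + l) = B p + ∑ j ∈ Finset.range l, b (p + j) := Finset.sum_range_add b p l
  have h2 : B ((p + l) % n) = B (p + l) :=
    (show Function.Periodic B n from hper).map_mod_nat (p + l)
  have h3 := hmin _ (Finset.mem_range.2 (Nat.mod_lt (p + l) hn))
  linarith

/-- Any `2π`-periodic configuration of `n` points admits a location at which the potential is at
most that of the equally spaced configuration at the midpoint of an arc. -/
lemma exists_sum_logSinKernel_le (t : ℕ → ℝ) {n : ℕ} (hn : 1 ≤ n) (hmono : Monotone t)
    (ht : ∀ i, t (i + n) = t i + 2 * π) :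
    ∃ φ : ℝ, (∀ j < n, sin ((t j - φ) / 2) ≠ 0) ∧ ∀ k, Odd k →
      ∑ j ∈ Finset.range n, logSinKernel k (t j - φ) ≤
        ∑ j ∈ Finset.range n, logSinKernel k ((2 * j + 1) * π / n) := by
  have hn0 : (0 : ℝ) < n := by exact_mod_cast hn
  set A : ℝ := (∑ j ∈ Finset.range n, (t j - 2 * π * j / n)) / n with hA
  set b : ℕ → ℝ := fun i => t i - 2 * π * i / n - A with hbdef
  have hb (i) : b (i + n) = b i := by
    simp only [hbdef, ht]
    push_cast
    field_simp
    ring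
  have h0 : ∑ j ∈ Finset.range n, b j = 0 := by
    simp only [hbdef]
    rw [Finset.sum_sub_distrib, Finset.sum_const, Finset.card_range, nsmul_eq_mul, hA,
      mul_div_cancel₀ _ hn0.ne', sub_self]
  obtain ⟨p, hp, hpos⟩ := exists_shift_partial_sums_nonneg b hn hb h0
  have h0p : ∑ j ∈ Finset.range n, b (p + j) = 0 := by
    rw [sum_range_shift_of_periodic b n p hb, h0]
  set φ : ℝ := 2 * π * p / n + A - π / n with hφ
  set x : ℕ → ℝ := fun j => t (p + j) - φ with hx
  set y : ℕ → ℝ := fun j => (2 * j + 1) * π / n with hy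
  have hxy (j) : x j - y j = b (p + j) := by
    simp only [hx, hy, hbdef, hφ]
    push_cast
    field_simp
    ring
  have hymem (j) (hj : j < n) : y j ∈ Ioo 0 (2 * π) := by
    have hj' : (j : ℝ) + 1 ≤ n := by exact_mod_cast hj
    refine ⟨by positivity, ?_⟩
    simp only [hy]
    rw [div_lt_iff₀ hn0]
    nlinarith [pi_pos]
  have hxmono : Monotone x := fun i j hij => sub_le_sub_right (hmono (by omega)) _
  have hx0 : y 0 ≤ x 0 := by
    have := hpos 1
    rw [Finset.sum_range_one, ← hxy] at this
    linarith
  have hxn : x (n - 1) ≤ y (n - 1) := by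
    have h1 := Finset.sum_range_succ (fun j => b (p + j)) (n - 1)
    rw [Nat.sub_add_cancel hn, h0p, ← hxy] at h1
    linarith [hpos (n - 1)]
  have hxmem (j) (hj : j < n) : x j ∈ Ioo 0 (2 * π) :=
    ⟨((hymem 0 hn).1.trans_le hx0).trans_le (hxmono (Nat.zero_le j)),
      ((hxmono (Nat.le_sub_one_of_lt hj)).trans hxn).trans_lt (hymem (n - 1) (by omega)).2⟩
  refine ⟨φ, fun j hj => ?_, fun k hk => ?_⟩
  · rcases le_or_gt p j with h | h
    · have := sin_half_ne_zero (hxmem (j - p) (by omega))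
      simpa [hx, Nat.add_sub_cancel' h] using this
    · have := sin_half_ne_zero (hxmem (j + n - p) (by omega))
      simp only [hx] at this
      rw [Nat.add_sub_cancel' (by omega), ht, show (t j + 2 * π - φ) / 2 = (t j - φ) / 2 + π by ring,
        sin_add_pi] at this
      simpa using this
  · rw [← sum_range_shift_of_periodic (fun j => logSinKernel k (t j - φ)) n p]
    · exact sum_logSinKernel_le_of_partial_sums hk x y n hxmem hymem hxmono
        (fun l => by simpa only [hxy] using hpos l) (by simpa only [hxy] using h0p)
    · intro i
      rw [ht, add_sub_right_comm, logSinKernel_periodic]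

/-- Points of the circle can be lifted to a monotone sequence that advances by a full turn after
`n` steps. -/
lemma exists_monotone_lift {n : ℕ} (hn : 1 ≤ n) (ω : Fin n → ℝ) :
    ∃ (t : ℕ → ℝ) (σ : Equiv.Perm (Fin n)) (z : Fin n → ℤ), Monotone t ∧
      (∀ i, t (i + n) = t i + 2 * π) ∧ ∀ j : Fin n, t j = ω (σ j) - z j * (2 * π) := by
  set r : Fin n → ℝ := fun j => toIcoMod two_pi_pos 0 (ω j) with hr
  have hr0 (j) : 0 ≤ r j := (toIcoMod_mem_Ico two_pi_pos 0 (ω j)).1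
  have hr1 (j) : r j < 2 * π := by
    have := (toIcoMod_mem_Ico two_pi_pos 0 (ω j)).2
    rwa [zero_add] at this
  set σ := Tuple.sort r
  have hσ : Monotone (r ∘ σ) := Tuple.monotone_sort r
  refine ⟨fun i => r (σ ⟨i % n, Nat.mod_lt i hn⟩) + (i / n : ℕ) * (2 * π), σ,
    fun j => toIcoDiv two_pi_pos 0 (ω (σ j)), ?_, ?_, ?_⟩
  · intro i j hij
    have hdiv : i / n ≤ j / n := Nat.div_le_div_right hij
    rcases hdiv.eq_or_lt with h | h
    · have hmod : i % n ≤ j % n := by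
        have h1 := Nat.div_add_mod i n
        have h2 := Nat.div_add_mod j n
        rw [h] at h1
        omega
      simp only [h]
      have := hσ (show (⟨i % n, Nat.mod_lt i hn⟩ : Fin n) ≤ ⟨j % n, Nat.mod_lt j hn⟩ from hmod)
      simp only [Function.comp_apply] at this
      linarith
    · have h' : ((i / n : ℕ) : ℝ) + 1 ≤ (j / n : ℕ) := by exact_mod_cast h
      have := mul_le_mul_of_nonneg_right h' two_pi_pos.le
      have h1 := hr1 (σ ⟨i % n, Nat.mod_lt i hn⟩)
      have h2 := hr0 (σ ⟨j % n, Nat.mod_lt j hn⟩)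
      simp only
      linarith
  · intro i
    simp only [Nat.add_mod_right, Nat.add_div_right i hn]
    push_cast
    ring
  · intro j
    simp only [Nat.mod_eq_of_lt j.2, Nat.div_eq_of_lt j.2, hr, toIcoMod, zsmul_eq_mul]
    simp

lemma exists_fin_sum_logSinKernel_le {n : ℕ} (hn : 1 ≤ n) (ω : Fin n → ℝ) :
    ∃ φ ∈ Ico 0 (2 * π), ∏ j, sin ((φ - ω j) / 2) ≠ 0 ∧ ∀ k, Odd k →
      ∑ j, logSinKernel k (φ - ω j) ≤ ∑ j : Fin n, logSinKernel k (π / n - 2 * π * j / n) := by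
  obtain ⟨t, σ, z, hmono, ht, hω⟩ := exists_monotone_lift hn ω
  obtain ⟨φ, hφ, hle⟩ := exists_sum_logSinKernel_le t hn hmono ht
  set q := toIcoDiv two_pi_pos 0 φ
  have hq : toIcoMod two_pi_pos 0 φ = φ - q * (2 * π) := by rw [toIcoMod, zsmul_eq_mul]
  have hdiff (j : Fin n) : toIcoMod two_pi_pos 0 φ - ω (σ j) =
      -(t j - φ) + (-(z j + q) : ℤ) * (2 * π) := by
    rw [hq, hω]
    push_cast
    ring
  refine ⟨toIcoMod two_pi_pos 0 φ, by simpa using toIcoMod_mem_Ico two_pi_pos 0 φ, ?_, ?_⟩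
  · refine Finset.prod_ne_zero_iff.2 fun j _ => ?_
    obtain ⟨j, rfl⟩ := σ.surjective j
    rw [hdiff, show ∀ a b : ℝ, (-a + b * (2 * π)) / 2 = -(a / 2) + b * π by intros; ring,
      sin_add_int_mul_pi, sin_neg]
    refine mul_ne_zero (zpow_ne_zero _ (by norm_num)) (neg_ne_zero.2 (hφ j j.2))
  · intro k hk
    have h1 : ∑ j, logSinKernel k (toIcoMod two_pi_pos 0 φ - ω j) =
        ∑ j ∈ Finset.range n, logSinKernel k (t j - φ) := by
      rw [← Equiv.sum_comp σ, ← Fin.sum_univ_eq_sum_range (fun j => logSinKernel k (t j - φ))]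
      refine Finset.sum_congr rfl fun j _ => ?_
      rw [hdiff, ((logSinKernel_periodic k).int_mul _) _, logSinKernel_neg hk]
    have h2 : ∑ j : Fin n, logSinKernel k (π / n - 2 * π * j / n) =
        ∑ j ∈ Finset.range n, logSinKernel k ((2 * j + 1) * π / n) := by
      rw [Fin.sum_univ_eq_sum_range (fun j => logSinKernel k (π / n - 2 * π * j / n)) n,
        ← sum_range_shift_of_periodic _ n 1]
      · refine Finset.sum_congr rfl fun j _ => ?_
        rw [← logSinKernel_neg hk]
        congr 1
        push_cast
        ring
      · intro i
        rw [← logSinKernel_periodic k]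
        congr 1
        push_cast
        have : (n : ℝ) ≠ 0 := by positivity
        field_simp
        ring
    rw [h1, h2]
    exact hle k hk

end Majorization

/-- Polarization for the kernels `g_m`: the maximum over configurations of the minimum of
`-(log|Q_{ω_n}|)^{(m)}` over the circle (away from the zeros of `Q_{ω_n}`) equals
`-(log|T_n|)^{(m)}(π/n)`. -/
theorem log_Q_polarization (n : ℕ) (hn : 1 ≤ n) (m : ℕ) (hm : Even m) (hm2 : 2 ≤ m) :
    IsGreatest
      {v : ℝ | ∃ ω : Fin n → ℝ, v = sInf ((fun t : ℝ =>
          -(iteratedDeriv m (fun s => Real.log |∏ j, Real.sin ((s - ω j) / 2)|) t)) ''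
        {t ∈ Set.Ico (0 : ℝ) (2 * Real.pi) | ∏ j, Real.sin ((t - ω j) / 2) ≠ 0})}
      (-(iteratedDeriv m
          (fun s => Real.log |(2 : ℝ) ^ ((1 : ℤ) - n) * Real.sin (n * s / 2)|)
          (Real.pi / n))) := by
  obtain ⟨k, rfl⟩ : ∃ k, m = k + 1 := ⟨m - 1, by omega⟩
  have hk : Odd k := by
    rw [← Nat.not_even_iff_odd]
    exact Nat.even_add_one.1 hm
  have hn0 : (0 : ℝ) < n := by exact_mod_cast hn
  have hQ {ω : Fin n → ℝ} {t : ℝ} (ht : ∏ j, sin ((t - ω j) / 2) ≠ 0) :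
      -(iteratedDeriv (k + 1) (fun s => log |∏ j, sin ((s - ω j) / 2)|) t) =
        ∑ j, logSinKernel k (t - ω j) := by
    have h := iteratedDeriv_log_prod_sin one_ne_zero ω k ht
    simp only [one_mul] at h
    rw [h, neg_neg]
  have hT : (fun s : ℝ => log |(2 : ℝ) ^ ((1 : ℤ) - n) * sin (n * s / 2)|) =
      fun s => log |∏ j : Fin n, sin ((s - 2 * π * j / n) / 2)| :=
    funext fun s => by rw [abs_prod_sin_equally_spaced hn]
  have hTne (t : ℝ) : ∏ j : Fin n, sin ((t - 2 * π * j / n) / 2) ≠ 0 ↔ sin (n * t / 2) ≠ 0 := by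
    rw [← abs_ne_zero, abs_prod_sin_equally_spaced hn, abs_ne_zero, mul_ne_zero_iff]
    exact and_iff_right (zpow_ne_zero _ two_ne_zero)
  have hTval {t : ℝ} (ht : sin (n * t / 2) ≠ 0) :
      -(iteratedDeriv (k + 1) (fun s : ℝ => log |(2 : ℝ) ^ ((1 : ℤ) - n) * sin (n * s / 2)|) t) =
        (n : ℝ) ^ (k + 1) * logSinKernel k (n * t) := by
    have h := iteratedDeriv_log_prod_sin (ι := Unit) (c := (2 : ℝ) ^ ((1 : ℤ) - n))
      (zpow_ne_zero _ two_ne_zero) 0 k (t := n * t) (by simpa using ht)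
    have h2 := congrFun (iteratedDeriv_comp_mul_left_field (k + 1)
      (fun s => log |(2 : ℝ) ^ ((1 : ℤ) - n) * sin (s / 2)|) n) t
    simp only [Finset.univ_unique, Finset.prod_singleton, Finset.sum_singleton, Pi.zero_apply,
      sub_zero] at h
    rw [h2, h]
    ring
  have hmid : (n : ℝ) * (π / n) = π := by field_simp
  have hmid0 : sin (n * (π / n) / 2) ≠ 0 := by rw [hmid]; simp
  constructor
  · refine ⟨fun j => 2 * π * j / n, ?_⟩
    rw [← hT]
    have hmem : π / n ∈
        {t ∈ Ico (0 : ℝ) (2 * π) | ∏ j : Fin n, sin ((t - 2 * π * j / n) / 2) ≠ 0} := by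
      refine ⟨⟨by positivity, ?_⟩, (hTne _).2 hmid0⟩
      rw [div_lt_iff₀ hn0]
      have : (1 : ℝ) ≤ n := by exact_mod_cast hn
      nlinarith [pi_pos]
    symm
    refine IsLeast.csInf_eq ⟨mem_image_of_mem _ hmem, ?_⟩
    rintro _ ⟨t, ⟨-, ht⟩, rfl⟩
    simp only
    rw [hTval hmid0, hTval ((hTne t).1 ht), hmid]
    exact mul_le_mul_of_nonneg_left (logSinKernel_pi_le hk _) (by positivity)
  · rintro _ ⟨ω, rfl⟩
    obtain ⟨φ, hφ, hne, hle⟩ := exists_fin_sum_logSinKernel_le hn ω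
    have hmem : φ ∈ {t ∈ Ico (0 : ℝ) (2 * π) | ∏ j, sin ((t - ω j) / 2) ≠ 0} := ⟨hφ, hne⟩
    refine (csInf_le ⟨0, ?_⟩ (mem_image_of_mem _ hmem)).trans ?_
    · rintro _ ⟨t, ⟨-, ht⟩, rfl⟩
      simp only
      rw [hQ ht]
      exact Finset.sum_nonneg fun j _ => logSinKernel_nonneg hk _
    · rw [hQ hne, hT, hQ ((hTne _).2 hmid0)]
      exact hle k hk
end
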